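/- Let n be even and let e₀, e₁, …, e_{n+1} be N×N complex self-adjoint idempotent matrices with ‖eᵢ − eⱼ‖ < 1/2 for all i, j. Then the spectral-projector family E is differentiable on the relevant simplices and the Alexander–Spanier coboundary of Chⁿ vanishes: Σ_{j=0}^{n+1} (−1)ʲ Chⁿ(e₀, …, êⱼ, …, e_{n+1}) = 0, where êⱼ means that eⱼ is omitted. -/

import Mathlib

open scoped Matrix.Norms.L2Operator
open Matrix MeasureTheory

/-- The standard `n`-simplex `Δⁿ = {t ∈ ℝⁿ : tᵢ ≥ 0, Σᵢ tᵢ ≤ 1}`. -/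
def simplexΔ (n : ℕ) : Set (Fin n → ℝ) := {t | (∀ i, 0 ≤ t i) ∧ ∑ i, t i ≤ 1}

/-- `a(t) = Σⱼ₌₀ⁿ tⱼ eⱼ`, with `t₀ = 1 − Σᵢ₌₁ⁿ tᵢ`. -/
noncomputable def simplexComb {n N : ℕ} (e : Fin (n + 1) → Matrix (Fin N) (Fin N) ℂ)
    (t : Fin n → ℝ) : Matrix (Fin N) (Fin N) ℂ :=
  (((1 - ∑ i, t i : ℝ)) : ℂ) • e 0 + ∑ i : Fin n, ((t i : ℝ) : ℂ) • e i.succ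

/-- The Riesz (spectral) projector `E(t) = (1/2πi) ∮_{|λ−1|=1/2} (λ·1 − a(t))⁻¹ dλ`
onto the part of the spectrum of `a(t) = Σⱼ tⱼ eⱼ` near `1`. -/
noncomputable def rieszComb {n N : ℕ} (e : Fin (n + 1) → Matrix (Fin N) (Fin N) ℂ)
    (t : Fin n → ℝ) : Matrix (Fin N) (Fin N) ℂ :=
  (2 * Real.pi * Complex.I)⁻¹ •
    ∮ z in C(1, 1 / 2), (z • (1 : Matrix (Fin N) (Fin N) ℂ) - simplexComb e t)⁻¹

/-- The constant `bₙ = (−1)^(n/2) / ((2πi)^(n/2) (n/2)!)`. -/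
noncomputable def evenChernConst (n : ℕ) : ℂ :=
  (-1) ^ (n / 2) / ((2 * Real.pi * Complex.I) ^ (n / 2) * (Nat.factorial (n / 2) : ℂ))

/-- The even Chern character cochain
`Chⁿ(e₀,…,eₙ) = bₙ ∫_{Δⁿ} Σ_{σ∈Sₙ} sgn σ · tr(E(t) ∂E/∂t_{σ(1)} ⋯ ∂E/∂t_{σ(n)}) dt`. -/
noncomputable def chEven (n N : ℕ) (e : Fin (n + 1) → Matrix (Fin N) (Fin N) ℂ) : ℂ :=
  evenChernConst n *
    ∫ t in simplexΔ n, ∑ σ : Equiv.Perm (Fin n),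
      ((Equiv.Perm.sign σ : ℤ) : ℂ) *
        Matrix.trace
          (rieszComb e t *
            (((List.finRange n).map fun i =>
              fderiv ℝ (rieszComb e) t (Pi.single (σ i) 1)).prod))


section Closed

lemma perm_sum_succ {n : ℕ} {X : Type*} (M : (Fin (n + 1) → X) → ℂ) (v : Fin (n + 1) → X) :
    ∑ i : Fin (n + 1), (-1 : ℂ) ^ (i : ℕ) * ∑ σ : Equiv.Perm (Fin n),
      ((Equiv.Perm.sign σ : ℤ) : ℂ) * M (Fin.cons (v i) (fun k => v (i.succAbove (σ k)))) =
    ∑ τ : Equiv.Perm (Fin (n + 1)), ((Equiv.Perm.sign τ : ℤ) : ℂ) * M (v ∘ τ) := by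
  simp_rw [Finset.mul_sum]
  rw [← Fintype.sum_prod_type' (f := fun (i : Fin (n + 1)) (σ : Equiv.Perm (Fin n)) =>
    (-1 : ℂ) ^ (i : ℕ) * (((Equiv.Perm.sign σ : ℤ) : ℂ) *
      M (Fin.cons (v i) (fun k => v (i.succAbove (σ k))))))]
  have h0 : ∀ p : Fin (n + 1) × Equiv.Perm (Fin n),
      (p.1.cycleRange.symm * Equiv.Perm.decomposeFin.symm (0, p.2) : Equiv.Perm (Fin (n + 1))) 0
        = p.1 := by
    intro p; simp [Equiv.Perm.mul_apply]
  have hs : ∀ p : Fin (n + 1) × Equiv.Perm (Fin n), ∀ k : Fin n,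
      (p.1.cycleRange.symm * Equiv.Perm.decomposeFin.symm (0, p.2) : Equiv.Perm (Fin (n + 1))) k.succ
        = p.1.succAbove (p.2 k) := by
    intro p k; simp [Equiv.Perm.mul_apply]
  refine Fintype.sum_bijective (fun p : Fin (n + 1) × Equiv.Perm (Fin n) =>
    (p.1.cycleRange.symm * Equiv.Perm.decomposeFin.symm (0, p.2) : Equiv.Perm (Fin (n + 1))))
    ?_ _ _ ?_
  · rw [Fintype.bijective_iff_injective_and_card]
    constructor
    · intro p q hpq
      have h1 : p.1 = q.1 := by
        rw [← h0 p, ← h0 q]; exact congrArg (fun τ : Equiv.Perm (Fin (n + 1)) => τ 0) hpq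
      refine Prod.ext h1 ?_
      ext1 k
      have := (hs p k).symm.trans
        ((congrArg (fun τ : Equiv.Perm (Fin (n + 1)) => τ k.succ) hpq).trans (hs q k))
      rw [h1] at this
      exact Fin.succAbove_right_injective this
    · simp [Fintype.card_perm, Nat.factorial_succ]
  · intro p
    have hsgn : ((Equiv.Perm.sign (p.1.cycleRange.symm * Equiv.Perm.decomposeFin.symm (0, p.2) :
        Equiv.Perm (Fin (n + 1))) : ℤ) : ℂ) = (-1 : ℂ) ^ (p.1 : ℕ) *
        ((Equiv.Perm.sign p.2 : ℤ) : ℂ) := by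
      rw [Equiv.Perm.sign_mul, Equiv.Perm.sign_symm, Fin.sign_cycleRange,
        Equiv.Perm.decomposeFin.symm_sign]
      simp
    rw [hsgn, ← mul_assoc]
    congr 2
    funext k
    refine Fin.cases ?_ (fun k => ?_) k
    · simp only [Fin.cons_zero, Function.comp]; rw [h0 p]
    · simp only [Fin.cons_succ, Function.comp]; rw [hs p]

lemma perm_sum_eq_zero_of_swap {m : ℕ} {X : Type*} (M : (Fin m → X) → ℂ) (v : Fin m → X)
    (a b : Fin m) (hab : a ≠ b) (hM : ∀ w, M (w ∘ Equiv.swap a b) = M w) :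
    ∑ τ : Equiv.Perm (Fin m), ((Equiv.Perm.sign τ : ℤ) : ℂ) * M (v ∘ τ) = 0 := by
  have h : ∑ τ : Equiv.Perm (Fin m), ((Equiv.Perm.sign τ : ℤ) : ℂ) * M (v ∘ τ) =
      - ∑ τ : Equiv.Perm (Fin m), ((Equiv.Perm.sign τ : ℤ) : ℂ) * M (v ∘ τ) := by
    conv_lhs => rw [← Equiv.sum_comp (Equiv.mulRight (Equiv.swap a b))]
    rw [← Finset.sum_neg_distrib]
    refine Finset.sum_congr rfl fun τ _ => ?_
    have : M (v ∘ ⇑(τ * Equiv.swap a b)) = M (v ∘ τ) := by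
      rw [← hM (v ∘ τ)]; rfl
    simp only [Equiv.coe_mulRight, this, Equiv.Perm.sign_mul, Equiv.Perm.sign_swap hab]
    simp
  exact self_eq_neg.mp h

variable {A : Type*} [NormedRing A] [NormedAlgebra ℝ A]
variable {X : Type*} [NormedAddCommGroup X] [NormedSpace ℝ X]

/-- The non-antisymmetrised form `tr (E dE ⋯ dE)`. -/
noncomputable def preForm (T : A →L[ℝ] ℂ) (E : X → A) (n : ℕ) (x : X) (v : Fin n → X) : ℂ :=
  T (E x * ContinuousMultilinearMap.mkPiAlgebraFin ℝ n A (fun i => fderiv ℝ E x (v i)))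

/-- The antisymmetrised form `tr (E dE ⋯ dE)`. -/
noncomputable def traceForm (T : A →L[ℝ] ℂ) (E : X → A) (n : ℕ) (x : X) (v : Fin n → X) : ℂ :=
  ∑ σ : Equiv.Perm (Fin n), ((Equiv.Perm.sign σ : ℤ) : ℂ) * preForm T E n x (v ∘ σ)

lemma hasFDerivAt_preForm (T : A →L[ℝ] ℂ) (E : X → A) (n : ℕ) (x : X) (v : Fin n → X)
    (hE : ContDiffAt ℝ 2 E x) :
    HasFDerivAt (fun y => preForm T E n y v)
      (T ∘L ((E x • ∑ k : Fin n, ((ContinuousMultilinearMap.mkPiAlgebraFin ℝ n A).toContinuousLinearMap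
          (fun j => fderiv ℝ E x (v j)) k) ∘L ((fderiv ℝ (fderiv ℝ E) x).flip (v k)))
        + (fderiv ℝ E x).smulRight
            (ContinuousMultilinearMap.mkPiAlgebraFin ℝ n A (fun i => fderiv ℝ E x (v i))))) x := by
  have h1 : HasFDerivAt E (fderiv ℝ E x) x := (hE.differentiableAt (by norm_num)).hasFDerivAt
  have h2 : HasFDerivAt (fderiv ℝ E) (fderiv ℝ (fderiv ℝ E) x) x :=
    ((hE.fderiv_right (m := 1) (by norm_num)).differentiableAt (by norm_num)).hasFDerivAt
  have h3 : ∀ k, HasFDerivAt (fun y => fderiv ℝ E y (v k)) ((fderiv ℝ (fderiv ℝ E) x).flip (v k)) x := by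
    intro k
    have := h2.clm_apply (hasFDerivAt_const (v k) x)
    simpa using this
  have h4 := HasFDerivAt.multilinear_comp (f := ContinuousMultilinearMap.mkPiAlgebraFin ℝ n A) h3
  exact T.hasFDerivAt.comp x (h1.mul' h4)

lemma fderiv_preForm_apply (T : A →L[ℝ] ℂ) (E : X → A) (n : ℕ) (x : X) (v : Fin n → X)
    (hE : ContDiffAt ℝ 2 E x) (w : X) :
    fderiv ℝ (fun y => preForm T E n y v) x w =
      T (fderiv ℝ E x w *
        ContinuousMultilinearMap.mkPiAlgebraFin ℝ n A (fun i => fderiv ℝ E x (v i)))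
      + ∑ k : Fin n, T (E x * ContinuousMultilinearMap.mkPiAlgebraFin ℝ n A
          (Function.update (fun i => fderiv ℝ E x (v i)) k (fderiv ℝ (fderiv ℝ E) x w (v k)))) := by
  rw [(hasFDerivAt_preForm T E n x v hE).fderiv]
  simp [Finset.mul_sum, add_comm, ContinuousMultilinearMap.toContinuousLinearMap]

lemma anticomm_prod (u : A) (l : List A) (h : ∀ p ∈ l, u * p = -(p * u)) :
    u * l.prod = (-1) ^ l.length * (l.prod * u) := by
  induction l with
  | nil => simp
  | cons p l ih =>
    have ih' := ih (fun q hq => h q (List.mem_cons_of_mem _ hq))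
    rw [List.prod_cons, ← mul_assoc, h p List.mem_cons_self, List.length_cons, neg_mul, mul_assoc,
      ih', pow_succ]
    rcases neg_one_pow_eq_or A l.length with h | h <;> rw [h] <;> noncomm_ring

lemma trace_prod_odd_eq_zero (T : A →L[ℝ] ℂ) (hT : ∀ a b, T (a * b) = T (b * a))
    (u : A) (hu : u * u = 1) (l : List A) (hl : Odd l.length)
    (h : ∀ p ∈ l, u * p = -(p * u)) : T l.prod = 0 := by
  have h1 := anticomm_prod u l h
  rw [hl.neg_one_pow] at h1
  have h2 : T (u * (u * l.prod)) = T l.prod := by rw [← mul_assoc, hu, one_mul]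
  have h3 : T (u * (u * l.prod)) = - T l.prod := by
    rw [hT, h1, neg_one_mul, neg_mul, mul_assoc, hu, mul_one, map_neg]
  exact self_eq_neg.mp (h2.symm.trans h3)

lemma closed_traceForm (T : A →L[ℝ] ℂ) (hT : ∀ a b, T (a * b) = T (b * a))
    (E : X → A) (n : ℕ) (hn : Even n) (x : X) (hE : ContDiffAt ℝ 2 E x)
    (hidem : ∀ᶠ y in nhds x, E y * E y = E y) (v : Fin (n + 1) → X) :
    ∑ i : Fin (n + 1), (-1 : ℂ) ^ (i : ℕ) *
      fderiv ℝ (fun y => traceForm T E n y (v ∘ i.succAbove)) x (v i) = 0 := by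
  have hfd : ∀ i : Fin (n + 1), fderiv ℝ (fun y => traceForm T E n y (v ∘ i.succAbove)) x (v i) =
      ∑ σ : Equiv.Perm (Fin n), ((Equiv.Perm.sign σ : ℤ) : ℂ) *
        fderiv ℝ (fun y => preForm T E n y ((v ∘ i.succAbove) ∘ σ)) x (v i) := by
    intro i
    have : HasFDerivAt (fun y => traceForm T E n y (v ∘ i.succAbove))
        (∑ σ : Equiv.Perm (Fin n), ((Equiv.Perm.sign σ : ℤ) : ℂ) •
          fderiv ℝ (fun y => preForm T E n y ((v ∘ i.succAbove) ∘ σ)) x) x := by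
      refine HasFDerivAt.fun_sum fun σ _ => ?_
      exact ((hasFDerivAt_preForm T E n x _ hE).differentiableAt.hasFDerivAt).const_mul _
    rw [this.fderiv]
    simp
  simp_rw [hfd]
  -- the multilinear expression
  have hd1 : HasFDerivAt E (fderiv ℝ E x) x := (hE.differentiableAt (by norm_num)).hasFDerivAt
  have hder : ∀ w, E x * fderiv ℝ E x w + fderiv ℝ E x w * E x = fderiv ℝ E x w := by
    intro w
    have h1 := hd1.mul' hd1
    have h2 : HasFDerivAt (fun y => E y * E y) (fderiv ℝ E x) x :=
      hd1.congr_of_eventuallyEq hidem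
    have := congrArg (fun L => L w) (h1.unique h2)
    simpa using this
  have hxx : E x * E x = E x := hidem.self_of_nhds
  let M : (Fin (n + 1) → X) → ℂ := fun w =>
    fderiv ℝ (fun y => preForm T E n y (Fin.tail w)) x (w 0)
  have key := perm_sum_succ M v
  have : ∑ i : Fin (n + 1), (-1 : ℂ) ^ (i : ℕ) * ∑ σ : Equiv.Perm (Fin n),
      ((Equiv.Perm.sign σ : ℤ) : ℂ) *
        fderiv ℝ (fun y => preForm T E n y ((v ∘ i.succAbove) ∘ σ)) x (v i) =
      ∑ τ : Equiv.Perm (Fin (n + 1)), ((Equiv.Perm.sign τ : ℤ) : ℂ) * M (v ∘ τ) := by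
    rw [← key]
    refine Finset.sum_congr rfl fun i _ => ?_
    congr 1
  rw [this]
  have hM : ∀ w, M w = ∑ k : Fin n, T (E x * ContinuousMultilinearMap.mkPiAlgebraFin ℝ n A
          (Function.update (fun i => fderiv ℝ E x (w i.succ)) k
            (fderiv ℝ (fderiv ℝ E) x (w 0) (w k.succ)))) := by
    intro w
    simp only [M]
    rw [fderiv_preForm_apply T E n x _ hE]
    have hz : T (fderiv ℝ E x (w 0) *
        ContinuousMultilinearMap.mkPiAlgebraFin ℝ n A (fun i => fderiv ℝ E x (Fin.tail w i))) = 0 := by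
      rw [ContinuousMultilinearMap.mkPiAlgebraFin_apply, ← List.prod_cons]
      refine trace_prod_odd_eq_zero T hT (2 * E x - 1) ?_ _ ?_ ?_
      · have : (2 * E x - 1) * (2 * E x - 1) = 4 * (E x * E x) - 4 * E x + 1 := by noncomm_ring
        rw [this, hxx]; simp
      · simpa using hn.add_one
      · have hp : ∀ w, (2 * E x - 1) * fderiv ℝ E x w = -(fderiv ℝ E x w * (2 * E x - 1)) := by
          intro w
          have h := hder w
          have : (2 * E x - 1) * fderiv ℝ E x w + fderiv ℝ E x w * (2 * E x - 1) =
            2 * (E x * fderiv ℝ E x w + fderiv ℝ E x w * E x) - 2 * fderiv ℝ E x w := by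
            noncomm_ring
          rw [h, sub_self] at this
          exact eq_neg_of_add_eq_zero_left this
        intro p hp'
        rcases List.mem_cons.mp hp' with rfl | hp'
        · exact hp _
        · obtain ⟨i, rfl⟩ := List.mem_ofFn.mp hp'
          exact hp _
    rw [hz, zero_add]
    rfl
  simp_rw [hM, Finset.mul_sum]
  rw [Finset.sum_comm]
  refine Finset.sum_eq_zero fun k _ => ?_
  have hsymm : IsSymmSndFDerivAt ℝ E x := hE.isSymmSndFDerivAt (by simp)
  refine perm_sum_eq_zero_of_swap (fun w => T (E x * ContinuousMultilinearMap.mkPiAlgebraFin ℝ n A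
          (Function.update (fun i => fderiv ℝ E x (w i.succ)) k
            (fderiv ℝ (fderiv ℝ E) x (w 0) (w k.succ))))) v 0 k.succ
            (Fin.succ_ne_zero k).symm ?_
  intro w
  have : (Function.update (fun i : Fin n => fderiv ℝ E x ((w ∘ Equiv.swap 0 k.succ) i.succ)) k
            (fderiv ℝ (fderiv ℝ E) x ((w ∘ Equiv.swap 0 k.succ) 0) ((w ∘ Equiv.swap 0 k.succ) k.succ)))
      = (Function.update (fun i => fderiv ℝ E x (w i.succ)) k
            (fderiv ℝ (fderiv ℝ E) x (w 0) (w k.succ))) := by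
    funext i
    by_cases hik : i = k
    · subst hik
      simp only [Function.update_self, Function.comp, Equiv.swap_apply_left, Equiv.swap_apply_right]
      exact hsymm _ _
    · rw [Function.update_of_ne hik, Function.update_of_ne hik]
      simp only [Function.comp]
      rw [Equiv.swap_apply_of_ne_of_ne (Fin.succ_ne_zero i) (by simpa using hik)]
  simp only [this]

end Closed

open MeasureTheory

section OrdSimplex

/-- extended coordinates `1, y₀, y₁, …, y_{m-1}, 0, 0, …`. -/
noncomputable def ordY {m : ℕ} (y : Fin m → ℝ) : ℕ → ℝ
  | 0 => 1
  | k + 1 => if h : k < m then y ⟨k, h⟩ else 0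

/-- The order simplex `1 ≥ y₀ ≥ ⋯ ≥ y_{m-1} ≥ 0`. -/
def ordO (m : ℕ) : Set (Fin m → ℝ) := {y | ∀ k, ordY y (k + 1) ≤ ordY y k}

lemma ordY_zero {m : ℕ} (y : Fin m → ℝ) : ordY y 0 = 1 := rfl

lemma ordY_succ {m : ℕ} (y : Fin m → ℝ) (k : ℕ) :
  ordY y (k + 1) = if h : k < m then y ⟨k, h⟩ else 0 := rfl

lemma ordY_fin {m : ℕ} (y : Fin m → ℝ) (k : Fin m) : ordY y (k + 1) = y k := by
  simp [ordY_succ]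

lemma ordY_of_gt {m : ℕ} (y : Fin m → ℝ) (k : ℕ) (hk : m < k) : ordY y k = 0 := by
  obtain ⟨k, rfl⟩ : ∃ l, k = l + 1 := ⟨k - 1, by omega⟩
  rw [ordY_succ, dif_neg (by omega)]

lemma continuous_ordY {m : ℕ} (k : ℕ) : Continuous fun y : Fin m → ℝ => ordY y k := by
  cases k with
  | zero => simpa [ordY_zero] using continuous_const
  | succ k =>
    simp only [ordY_succ]
    split_ifs
    · exact continuous_apply _
    · exact continuous_const

lemma isClosed_ordO (m : ℕ) : IsClosed (ordO m) := by
  have : ordO m = ⋂ k, {y | ordY y (k + 1) ≤ ordY y k} := by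
    ext; simp [ordO]
  rw [this]
  exact isClosed_iInter fun k => isClosed_le (continuous_ordY _) (continuous_ordY _)

lemma ordO_antitone {m : ℕ} {y : Fin m → ℝ} (hy : y ∈ ordO m) : Antitone (ordY y) :=
  antitone_nat_of_succ_le hy

lemma isCompact_ordO (m : ℕ) : IsCompact (ordO m) := by
  refine IsCompact.of_isClosed_subset (isCompact_Icc (a := (0 : Fin m → ℝ)) (b := 1))
    (isClosed_ordO m) ?_
  intro y hy
  have ha := ordO_antitone hy
  refine ⟨fun k => ?_, fun k => ?_⟩
  · rw [← ordY_fin y k, Pi.zero_apply, ← ordY_of_gt y (m + 1) (by omega)]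
    exact ha (by omega)
  · rw [← ordY_fin y k, Pi.one_apply, ← ordY_zero y]
    exact ha (by omega)

lemma ordY_insertNth {m : ℕ} (i : Fin (m + 1)) (s : ℝ) (z : Fin m → ℝ) (k : ℕ) :
    ordY (i.insertNth s z : Fin (m + 1) → ℝ) k =
      if k ≤ i then ordY z k else if k = i + 1 then s else ordY z (k - 1) := by
  cases k with
  | zero => simp [ordY_zero]
  | succ k =>
    rw [ordY_succ]
    by_cases hk : k < m + 1
    · rw [dif_pos hk]
      rcases lt_trichotomy k (i : ℕ) with h | h | h
      · rw [if_pos (by omega), ordY_succ, dif_pos (by omega)]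
        have : (⟨k, hk⟩ : Fin (m + 1)) = i.succAbove ⟨k, by omega⟩ := by
          rw [Fin.succAbove_of_castSucc_lt]
          · rfl
          · exact h
        rw [this, Fin.insertNth_apply_succAbove]
      · rw [if_neg (by omega), if_pos (by omega)]
        have : (⟨k, hk⟩ : Fin (m + 1)) = i := Fin.ext h
        rw [this, Fin.insertNth_apply_same]
      · rw [if_neg (by omega), if_neg (by omega)]
        obtain ⟨l, rfl⟩ : ∃ l, k = l + 1 := ⟨k - 1, by omega⟩
        rw [Nat.add_sub_cancel, ordY_succ, dif_pos (by omega)]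
        have : (⟨l + 1, hk⟩ : Fin (m + 1)) = i.succAbove ⟨l, by omega⟩ := by
          rw [Fin.succAbove_of_le_castSucc]
          · rfl
          · exact Fin.le_def.mpr (by simp; omega)
        rw [this, Fin.insertNth_apply_succAbove]
    · have := i.2
      rw [dif_neg hk, if_neg (by omega), if_neg (by omega), ordY_of_gt _ _ (by omega)]

lemma insertNth_mem_ordO {m : ℕ} (i : Fin (m + 1)) (s : ℝ) (z : Fin m → ℝ) :
    (i.insertNth s z : Fin (m + 1) → ℝ) ∈ ordO (m + 1) ↔
      z ∈ ordO m ∧ s ∈ Set.Icc (ordY z (i + 1)) (ordY z i) := by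
  simp only [ordO, Set.mem_ofPred_eq, ordY_insertNth, Set.mem_Icc]
  constructor
  · intro h
    have hi := h i
    have hi1 := h (i + 1)
    rw [if_neg (by omega), if_pos rfl, if_pos le_rfl] at hi
    rw [if_neg (by omega), if_neg (by omega), if_neg (by omega), if_pos rfl] at hi1
    simp only [Nat.add_sub_cancel] at hi1
    refine ⟨fun k => ?_, hi1, hi⟩
    rcases lt_trichotomy k (i : ℕ) with hk | hk | hk
    · have := h k
      rwa [if_pos (by omega), if_pos (by omega)] at this
    · rw [hk]; exact hi1.trans hi
    · have := h (k + 1)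
      rwa [if_neg (by omega), if_neg (by omega), if_neg (by omega), if_neg (by omega)] at this
  · rintro ⟨h, h1, h2⟩ k
    rcases lt_trichotomy k (i : ℕ) with hk | hk | hk
    · rw [if_pos (by omega), if_pos (by omega)]; exact h k
    · rw [if_neg (by omega), if_pos (by omega), if_pos (by omega), hk]; exact h2
    · rw [if_neg (by omega), if_neg (by omega), if_neg (by omega)]
      split_ifs with h3
      · rw [h3]; exact h1
      · obtain ⟨l, rfl⟩ : ∃ l, k = l + 1 := ⟨k - 1, by omega⟩
        exact h l

/-- The coface maps of the order simplices. -/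
noncomputable def ordFace {m : ℕ} (j : ℕ) (z : Fin m → ℝ) : Fin (m + 1) → ℝ :=
  fun k => ordY z (if (k : ℕ) + 1 ≤ j then k + 1 else k)

lemma ordY_ordFace {m : ℕ} (j : ℕ) (hj : j ≤ m + 1) (z : Fin m → ℝ) (k : ℕ) :
    ordY (ordFace j z) k = ordY z (if k ≤ j then k else k - 1) := by
  cases k with
  | zero => simp [ordY_zero]
  | succ k =>
    rw [ordY_succ]
    split_ifs with h1 h2 h2
    · simp [ordFace, h2]
    · simp [ordFace, h2]
    · omega
    · rw [ordY_of_gt]; omega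

lemma ordFace_eq_upper {m : ℕ} (i : Fin (m + 1)) (z : Fin m → ℝ) :
    ordFace i z = i.insertNth (ordY z i) z := by
  funext k
  rw [← ordY_fin (ordFace i z) k, ← ordY_fin (i.insertNth (ordY z i) z) k,
    ordY_ordFace _ (by omega), ordY_insertNth]
  split_ifs with h1 h2
  · rfl
  · rw [h2]; simp
  · rfl

lemma ordFace_eq_lower {m : ℕ} (i : Fin (m + 1)) (z : Fin m → ℝ) :
    ordFace (i + 1) z = i.insertNth (ordY z (i + 1)) z := by
  funext k
  rw [← ordY_fin (ordFace _ z) k, ← ordY_fin (i.insertNth _ z) k,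
    ordY_ordFace _ (by omega), ordY_insertNth]
  split_ifs with h1 h2 h3 h4 h5
  · rfl
  · rw [h3]
  · omega
  · omega
  · omega
  · rfl

lemma ordFace_mem {m : ℕ} (j : ℕ) (hj : j ≤ m + 1) (z : Fin m → ℝ) (hz : z ∈ ordO m) :
    ordFace j z ∈ ordO (m + 1) := by
  intro k
  rw [ordY_ordFace _ hj, ordY_ordFace _ hj]
  apply ordO_antitone hz
  split_ifs <;> omega

lemma continuous_ordFace {m : ℕ} (j : ℕ) : Continuous (ordFace j : (Fin m → ℝ) → _) :=
  continuous_pi fun _ => continuous_ordY _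

lemma integral_ordO_partial {m : ℕ} (G : (Fin (m + 1) → ℝ) → ℂ) (i : Fin (m + 1))
    (hG : ∀ y ∈ ordO (m + 1), ContDiffAt ℝ 1 G y) :
    ∫ y in ordO (m + 1), fderiv ℝ G y (Pi.single i 1) =
      ∫ z in ordO m, (G (ordFace i z) - G (ordFace (i + 1) z)) := by
  have hmeas : ∀ m, MeasurableSet (ordO m) := fun m => (isClosed_ordO m).measurableSet
  have hcont : ContinuousOn (fun y => fderiv ℝ G y (Pi.single i 1)) (ordO (m + 1)) := by
    intro y hy
    have h1 : ContinuousAt (fderiv ℝ G) y :=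
      ((hG y hy).fderiv_right (m := 0) (by norm_num)).continuousAt
    exact (h1.clm_apply continuousAt_const).continuousWithinAt
  have hInteg : IntegrableOn (fun y => fderiv ℝ G y (Pi.single i 1)) (ordO (m + 1)) :=
    hcont.integrableOn_compact (isCompact_ordO _)
  set H : (Fin (m + 1) → ℝ) → ℂ :=
    (ordO (m + 1)).indicator (fun y => fderiv ℝ G y (Pi.single i 1)) with hH
  have hHInteg : Integrable H := hInteg.integrable_indicator (hmeas _)
  have hmp := (volume_preserving_piFinSuccAbove (fun _ : Fin (m + 1) => ℝ) i).symm
  rw [← integral_indicator (hmeas _), ← integral_indicator (hmeas _), ← hH,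
    ← hmp.integral_comp' H]
  have hHInteg' : Integrable (fun p => H ((MeasurableEquiv.piFinSuccAbove (fun _ => ℝ) i).symm p))
      (volume.prod volume) :=
    (hmp.integrable_comp_emb (MeasurableEquiv.measurableEmbedding _)).mpr hHInteg
  rw [Measure.volume_eq_prod, integral_prod_symm _ hHInteg']
  refine integral_congr_ae (Filter.Eventually.of_forall fun z => ?_)
  change ∫ s, H (i.insertNth s z) = _
  by_cases hz : z ∈ ordO m
  · rw [Set.indicator_of_mem hz]
    have hle : ordY z (i + 1) ≤ ordY z i := hz i
    have : (fun s => H (i.insertNth s z)) = (Set.Icc (ordY z (i + 1)) (ordY z i)).indicator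
        (fun s => fderiv ℝ G (i.insertNth s z) (Pi.single i 1)) := by
      funext s
      by_cases hs : s ∈ Set.Icc (ordY z (i + 1)) (ordY z i)
      · rw [Set.indicator_of_mem hs, hH,
          Set.indicator_of_mem ((insertNth_mem_ordO i s z).mpr ⟨hz, hs⟩)]
      · rw [Set.indicator_of_notMem hs, hH,
          Set.indicator_of_notMem (fun h => hs ((insertNth_mem_ordO i s z).mp h).2)]
    rw [this, integral_indicator measurableSet_Icc, integral_Icc_eq_integral_Ioc,
      ← intervalIntegral.integral_of_le hle, ordFace_eq_upper, ordFace_eq_lower]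
    have hupd : ∀ s, (i.insertNth s z : Fin (m + 1) → ℝ) =
        Function.update (i.insertNth 0 z : Fin (m + 1) → ℝ) i s := by
      intro s; rw [Fin.update_insertNth]
    have hci : Continuous fun s : ℝ => (i.insertNth s z : Fin (m + 1) → ℝ) := by
      rw [funext hupd]; exact continuous_const.update i continuous_id
    refine intervalIntegral.integral_eq_sub_of_hasDerivAt
      (f := fun s => G (i.insertNth s z)) ?_ ?_
    · intro s hs
      rw [Set.uIcc_of_le hle] at hs
      have hm := (insertNth_mem_ordO i s z).mpr ⟨hz, hs⟩
      have h1 : HasFDerivAt G (fderiv ℝ G (i.insertNth s z)) (i.insertNth s z) :=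
        ((hG _ hm).differentiableAt (by norm_num)).hasFDerivAt
      have h2 : HasDerivAt (fun s : ℝ => (i.insertNth s z : Fin (m + 1) → ℝ)) (Pi.single i 1) s := by
        rw [funext hupd]; exact hasDerivAt_update _ i s
      exact h1.comp_hasDerivAt s h2
    · refine ContinuousOn.intervalIntegrable ?_
      rw [Set.uIcc_of_le hle]
      exact hcont.comp hci.continuousOn fun s hs => (insertNth_mem_ordO i s z).mpr ⟨hz, hs⟩
  · rw [Set.indicator_of_notMem hz]
    have : (fun s => H (i.insertNth s z)) = fun _ => 0 := by
      funext s
      rw [hH, Set.indicator_of_notMem (fun h => hz ((insertNth_mem_ordO i s z).mp h).1)]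
    rw [this]; simp

end OrdSimplex

open MeasureTheory

section Stokes

variable {A : Type*} [NormedRing A] [NormedAlgebra ℝ A]
variable {X : Type*} [NormedAddCommGroup X] [NormedSpace ℝ X]

lemma contDiffAt_traceForm (T : A →L[ℝ] ℂ) (E : X → A) (n : ℕ) (x : X) (v : Fin n → X)
    (hE : ContDiffAt ℝ 2 E x) : ContDiffAt ℝ 1 (fun y => traceForm T E n y v) x := by
  unfold traceForm preForm
  have hE1 : ContDiffAt ℝ 1 E x := hE.of_le (by norm_num)
  have hd : ContDiffAt ℝ 1 (fderiv ℝ E) x := hE.fderiv_right (by norm_num)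
  refine ContDiffAt.sum fun σ _ => contDiffAt_const.mul ?_
  refine T.contDiff.contDiffAt.comp x (hE1.mul ?_)
  refine (ContinuousMultilinearMap.contDiff _).contDiffAt.comp x ?_
  rw [contDiffAt_pi]
  intro i
  exact hd.clm_apply contDiffAt_const

lemma traceForm_update_add (T : A →L[ℝ] ℂ) (E : X → A) (n : ℕ) (x : X) (v : Fin n → X)
    (k : Fin n) (a b : X) :
    traceForm T E n x (Function.update v k (a + b)) =
      traceForm T E n x (Function.update v k a) + traceForm T E n x (Function.update v k b) := by
  unfold traceForm
  rw [← Finset.sum_add_distrib]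
  refine Finset.sum_congr rfl fun σ _ => ?_
  rw [← mul_add]
  congr 1
  have h : ∀ c : X, (fun i => fderiv ℝ E x ((Function.update v k c ∘ σ) i)) =
      Function.update (fun i => fderiv ℝ E x (v (σ i))) (σ.symm k) (fderiv ℝ E x c) := by
    intro c
    funext i
    by_cases hi : i = σ.symm k
    · subst hi; simp
    · have : σ i ≠ k := fun h => hi (by rw [← h]; simp)
      simp [Function.update_of_ne hi, Function.update_of_ne this]
  unfold preForm
  rw [h, h, h, map_add, ContinuousMultilinearMap.map_update_add, mul_add, map_add]

/-- The derivative of `ordY · p`. -/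
noncomputable def ordYL (m : ℕ) : ℕ → ((Fin m → ℝ) →L[ℝ] ℝ)
  | 0 => 0
  | k + 1 => if h : k < m then ContinuousLinearMap.proj ⟨k, h⟩ else 0

lemma hasFDerivAt_ordY {m : ℕ} (p : ℕ) (z : Fin m → ℝ) :
    HasFDerivAt (fun y : Fin m → ℝ => ordY y p) (ordYL m p) z := by
  cases p with
  | zero => simpa [ordY_zero, ordYL] using hasFDerivAt_const (1 : ℝ) z
  | succ k =>
    simp only [ordY_succ, ordYL]
    split_ifs with h
    · exact (ContinuousLinearMap.proj (R := ℝ) (φ := fun _ : Fin m => ℝ) ⟨k, h⟩).hasFDerivAt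
    · exact hasFDerivAt_const _ _

lemma ordYL_single {m : ℕ} (p : ℕ) (k : Fin m) :
    ordYL m p (Pi.single k 1) = if p = (k : ℕ) + 1 then 1 else 0 := by
  cases p with
  | zero => simp [ordYL]
  | succ q =>
    simp only [ordYL]
    by_cases h : q < m
    · rw [dif_pos h, ContinuousLinearMap.proj_apply, Pi.single_apply]
      simp [Fin.ext_iff]
    · rw [dif_neg h, if_neg (by omega)]; rfl

/-- The image of the basis vectors under the derivative of the coface map. -/
noncomputable def faceVec (m : ℕ) (j : ℕ) (k : Fin m) : Fin (m + 1) → ℝ :=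
  fun l => if (if (l : ℕ) + 1 ≤ j then (l : ℕ) + 1 else l) = (k : ℕ) + 1 then 1 else 0

lemma hasFDerivAt_ordFace {m : ℕ} (j : ℕ) (z : Fin m → ℝ) :
    HasFDerivAt (ordFace j : (Fin m → ℝ) → _)
      (ContinuousLinearMap.pi fun l : Fin (m + 1) =>
        ordYL m (if (l : ℕ) + 1 ≤ j then (l : ℕ) + 1 else l)) z := by
  rw [hasFDerivAt_pi]
  intro l
  exact hasFDerivAt_ordY _ z

lemma faceVec_lt {m j : ℕ} (k : Fin m) (h : (k : ℕ) + 1 < j) :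
    faceVec m j k = Pi.single k.castSucc 1 := by
  funext l
  simp only [faceVec, Pi.single_apply, Fin.ext_iff, Fin.val_castSucc]
  split_ifs <;> first | rfl | omega

lemma faceVec_gt {m j : ℕ} (k : Fin m) (h : j < (k : ℕ) + 1) :
    faceVec m j k = Pi.single k.succ 1 := by
  funext l
  simp only [faceVec, Pi.single_apply, Fin.ext_iff, Fin.val_succ]
  split_ifs <;> first | rfl | omega

lemma faceVec_eq {m j : ℕ} (k : Fin m) (h : (k : ℕ) + 1 = j) :
    faceVec m j k = Pi.single k.castSucc 1 + Pi.single k.succ 1 := by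
  funext l
  simp only [faceVec, Pi.add_apply, Pi.single_apply, Fin.ext_iff, Fin.val_succ, Fin.val_castSucc]
  split_ifs <;> first | omega | simp

lemma traceForm_comp_face (T : A →L[ℝ] ℂ) {n : ℕ} (E : (Fin (n + 1) → ℝ) → A) (j : ℕ)
    (z : Fin n → ℝ) (hE : DifferentiableAt ℝ E (ordFace j z)) :
    traceForm T (E ∘ ordFace j) n z (fun k => Pi.single k 1) =
      traceForm T E n (ordFace j z) (faceVec n j) := by
  unfold traceForm preForm
  refine Finset.sum_congr rfl fun σ _ => ?_
  have : ∀ k : Fin n, fderiv ℝ (E ∘ ordFace j) z (Pi.single k 1) =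
      fderiv ℝ E (ordFace j z) (faceVec n j k) := by
    intro k
    rw [(hE.hasFDerivAt.comp z (hasFDerivAt_ordFace j z)).fderiv]
    simp only [ContinuousLinearMap.comp_apply]
    congr 1
    funext l
    simp only [ContinuousLinearMap.coe_pi', ordYL_single, faceVec]
  simp only [Function.comp] at this ⊢
  simp only [this]

lemma traceForm_faceVec (T : A →L[ℝ] ℂ) {n : ℕ} (E : (Fin (n + 1) → ℝ) → A) (j : ℕ)
    (hj : j ≤ n + 1) (x : Fin (n + 1) → ℝ) :
    traceForm T E n x (faceVec n j) =
      (if h : j < n + 1 then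
        traceForm T E n x ((fun k => Pi.single k 1) ∘ Fin.succAbove ⟨j, h⟩) else 0) +
      (if h : 0 < j then
        traceForm T E n x ((fun k => Pi.single k 1) ∘ Fin.succAbove ⟨j - 1, by omega⟩) else 0) := by
  by_cases h0 : j = 0
  · subst h0
    rw [dif_pos (by omega), dif_neg (by omega), add_zero]
    congr 1
    funext k
    rw [faceVec_gt k (by omega)]
    rfl
  by_cases h1 : j = n + 1
  · subst h1
    rw [dif_neg (by omega), dif_pos (by omega), zero_add]
    congr 1
    funext k
    rw [faceVec_lt k (by omega)]
    simp only [Function.comp]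
    rw [Fin.succAbove_of_castSucc_lt]
    exact Fin.lt_def.mpr (by simp)
  rw [dif_pos (by omega), dif_pos (by omega)]
  have hk0 : j - 1 < n := by omega
  set k0 : Fin n := ⟨j - 1, hk0⟩ with hk
  have e1 : faceVec n j = Function.update (faceVec n j) k0
      (Pi.single k0.castSucc 1 + Pi.single k0.succ 1) := by
    rw [← faceVec_eq (j := j) k0 (by simp [hk]; omega), Function.update_eq_self]
  rw [e1, traceForm_update_add]
  congr 2
  · funext k
    by_cases hkk : k = k0
    · subst hkk
      rw [Function.update_self]
      simp only [Function.comp]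
      rw [Fin.succAbove_of_castSucc_lt]
      exact Fin.lt_def.mpr (by simp [hk]; omega)
    · rw [Function.update_of_ne hkk]
      have : (k : ℕ) ≠ j - 1 := fun h => hkk (Fin.ext h)
      simp only [Function.comp]
      rcases lt_or_gt_of_ne this with h | h
      · rw [faceVec_lt k (by omega), Fin.succAbove_of_castSucc_lt]
        exact Fin.lt_def.mpr (by simp; omega)
      · rw [faceVec_gt k (by omega), Fin.succAbove_of_le_castSucc]
        exact Fin.le_def.mpr (by simp; omega)
  · funext k
    by_cases hkk : k = k0
    · subst hkk
      rw [Function.update_self]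
      simp only [Function.comp]
      rw [Fin.succAbove_of_le_castSucc]
      exact Fin.le_def.mpr (by simp [hk])
    · rw [Function.update_of_ne hkk]
      have : (k : ℕ) ≠ j - 1 := fun h => hkk (Fin.ext h)
      simp only [Function.comp]
      rcases lt_or_gt_of_ne this with h | h
      · rw [faceVec_lt k (by omega), Fin.succAbove_of_castSucc_lt]
        exact Fin.lt_def.mpr (by simp; omega)
      · rw [faceVec_gt k (by omega), Fin.succAbove_of_le_castSucc]
        exact Fin.le_def.mpr (by simp; omega)

theorem ord_stokes (T : A →L[ℝ] ℂ) (hT : ∀ a b, T (a * b) = T (b * a)) {n : ℕ} (hn : Even n)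
    (E : (Fin (n + 1) → ℝ) → A)
    (hE : ∀ y ∈ ordO (n + 1), ContDiffAt ℝ 2 E y)
    (hidem : ∀ y ∈ ordO (n + 1), ∀ᶠ x in nhds y, E x * E x = E x) :
    ∑ j : Fin (n + 2), (-1 : ℂ) ^ (j : ℕ) *
      ∫ z in ordO n, traceForm T (E ∘ ordFace j) n z (fun k => Pi.single k 1) = 0 := by
  have hmeas : ∀ m, MeasurableSet (ordO m) := fun m => (isClosed_ordO m).measurableSet
  let G : Fin (n + 1) → (Fin (n + 1) → ℝ) → ℂ := fun i x =>
    traceForm T E n x ((fun k => Pi.single k 1) ∘ i.succAbove)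
  have hG : ∀ i, ∀ y ∈ ordO (n + 1), ContDiffAt ℝ 1 (G i) y := fun i y hy =>
    contDiffAt_traceForm T E n y _ (hE y hy)
  have hInteg : ∀ i, ∀ j ≤ n + 1, IntegrableOn (fun z => G i (ordFace j z)) (ordO n) := by
    intro i j hj
    refine ContinuousOn.integrableOn_compact (isCompact_ordO _) ?_
    have : ContinuousOn (G i) (ordO (n + 1)) := fun y hy =>
      (hG i y hy).continuousAt.continuousWithinAt
    exact this.comp (continuous_ordFace j).continuousOn fun z hz => ordFace_mem j hj z hz
  have hGint : ∀ i, IntegrableOn (fun y => fderiv ℝ (G i) y (Pi.single i 1)) (ordO (n + 1)) := by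
    intro i
    refine ContinuousOn.integrableOn_compact (isCompact_ordO _) ?_
    intro y hy
    have h1 : ContinuousAt (fderiv ℝ (G i)) y :=
      ((hG i y hy).fderiv_right (m := 0) (by norm_num)).continuousAt
    exact (h1.clm_apply continuousAt_const).continuousWithinAt
  have hzero : ∑ i : Fin (n + 1), (-1 : ℂ) ^ (i : ℕ) *
      ∫ y in ordO (n + 1), fderiv ℝ (G i) y (Pi.single i 1) = 0 := by
    simp_rw [← integral_const_mul]
    rw [← integral_finsetSum _ (fun i _ => (hGint i).const_mul _)]
    rw [setIntegral_congr_fun (g := fun _ => (0 : ℂ)) (hmeas _), integral_zero]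
    intro y hy
    exact closed_traceForm T hT E n hn y (hE y hy) (hidem y hy) (fun k => Pi.single k 1)
  have hface : ∀ j : Fin (n + 2),
      ∫ z in ordO n, traceForm T (E ∘ ordFace j) n z (fun k => Pi.single k 1) =
      (if h : (j : ℕ) < n + 1 then ∫ z in ordO n, G ⟨j, h⟩ (ordFace j z) else 0) +
      (if h : 0 < (j : ℕ) then ∫ z in ordO n, G ⟨j - 1, by omega⟩ (ordFace j z) else 0) := by
    intro j
    have hj : (j : ℕ) ≤ n + 1 := by omega
    have e1 : ∫ z in ordO n, traceForm T (E ∘ ordFace j) n z (fun k => Pi.single k 1) =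
        ∫ z in ordO n, ((if h : (j : ℕ) < n + 1 then G ⟨j, h⟩ (ordFace j z) else 0) +
          (if h : 0 < (j : ℕ) then G ⟨j - 1, by omega⟩ (ordFace j z) else 0)) := by
      refine setIntegral_congr_fun (hmeas _) fun z hz => ?_
      have hm := ordFace_mem j hj z hz
      rw [traceForm_comp_face T E j z ((hE _ hm).differentiableAt (by norm_num)),
        traceForm_faceVec T E j hj]
    rw [e1, integral_add]
    · congr 1 <;> split_ifs <;> simp
    · split_ifs
      · exact hInteg _ _ hj
      · exact integrable_zero _ _ _
    · split_ifs
      · exact hInteg _ _ hj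
      · exact integrable_zero _ _ _
  simp_rw [hface, mul_add]
  rw [Finset.sum_add_distrib, Fin.sum_univ_castSucc, Fin.sum_univ_succ (n := n + 1)]
  rw [dif_neg (show ¬ (0 < ((0 : Fin (n + 1 + 1)) : ℕ)) by simp), dif_neg (show ¬ (((Fin.last (n + 1)) : ℕ) < n + 1) by simp)]
  simp only [Fin.val_castSucc, Fin.is_lt, dif_pos, 
    mul_zero, add_zero, zero_add, Fin.val_succ, Nat.succ_pos, Nat.add_sub_cancel,
    Fin.eta]
  rw [← Finset.sum_add_distrib]
  refine Eq.trans ?_ hzero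
  refine Finset.sum_congr rfl fun i _ => ?_
  rw [integral_ordO_partial (G i) i (hG i), integral_sub (hInteg i _ (by omega)) (hInteg i _ (by omega))]
  ring

end Stokes

open MeasureTheory Matrix
open scoped Matrix.Norms.L2Operator

section Param

lemma hasFDerivAt_param {Y B : Type} [NormedAddCommGroup Y] [NormedSpace ℝ Y]
    [ProperSpace Y] [NormedAddCommGroup B] [NormedSpace ℝ B] (F : Y × ℝ → B) (V : Set Y)
    (hV : IsOpen V) (a b : ℝ)
    (hF : ∀ y ∈ V, ∀ θ, ContDiffAt ℝ (⊤ : ℕ∞) F (y, θ)) (y : Y) (hy : y ∈ V) :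
    HasFDerivAt (fun y => ∫ θ in a..b, F (y, θ))
      (∫ θ in a..b, (fderiv ℝ F (y, θ)).comp (ContinuousLinearMap.inl ℝ Y ℝ)) y := by
  obtain ⟨ε, hε, hsub⟩ := Metric.nhds_basis_closedBall.mem_iff.mp (hV.mem_nhds hy)
  have hcont : ∀ y ∈ V, ∀ θ, ContinuousAt F (y, θ) := fun y hy θ => (hF y hy θ).continuousAt
  have hcont' : ∀ y ∈ V, ∀ θ, ContinuousAt
      (fun p => (fderiv ℝ F p).comp (ContinuousLinearMap.inl ℝ Y ℝ)) (y, θ) := fun y hy θ =>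
    (((hF y hy θ).fderiv_right (m := 0) (by simp)).continuousAt).clm_comp continuousAt_const
  have hpair : ∀ y : Y, Continuous fun θ : ℝ => (y, θ) := fun y => by fun_prop
  have hc1 : ∀ y ∈ V, Continuous fun θ => F (y, θ) := fun y hy =>
    continuous_iff_continuousAt.mpr fun θ =>
      ContinuousAt.comp (f := fun θ : ℝ => (y, θ)) (hcont y hy θ) (hpair y).continuousAt
  have hc2 : ∀ y ∈ V, Continuous fun θ =>
      (fderiv ℝ F (y, θ)).comp (ContinuousLinearMap.inl ℝ Y ℝ) := fun y hy =>
    continuous_iff_continuousAt.mpr fun θ =>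
      ContinuousAt.comp (f := fun θ : ℝ => (y, θ)) (hcont' y hy θ) (hpair y).continuousAt
  obtain ⟨C, hC⟩ := (((isCompact_closedBall y ε).prod (isCompact_uIcc (a := a) (b := b))).exists_bound_of_continuousOn
    (f := fun p => (fderiv ℝ F p).comp (ContinuousLinearMap.inl ℝ Y ℝ))
    (fun p hp => (hcont' p.1 (hsub hp.1) p.2).continuousWithinAt))
  refine intervalIntegral.hasFDerivAt_integral_of_dominated_of_fderiv_le (bound := fun _ => C)
    (F' := fun y θ => (fderiv ℝ F (y, θ)).comp (ContinuousLinearMap.inl ℝ Y ℝ))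
    (Metric.closedBall_mem_nhds y hε) ?_ ?_ ?_ ?_ ?_ ?_
  · filter_upwards [hV.mem_nhds hy] with x hx
    exact (hc1 x hx).aestronglyMeasurable
  · exact (hc1 y hy).intervalIntegrable _ _
  · exact (hc2 y hy).aestronglyMeasurable
  · exact Filter.Eventually.of_forall fun θ hθ x hx => hC (x, θ) ⟨hx, Set.uIoc_subset_uIcc hθ⟩
  · simp
  · refine Filter.Eventually.of_forall fun θ _ x hx => ?_
    have h1 : HasFDerivAt F (fderiv ℝ F (x, θ)) (x, θ) :=
      ((hF x (hsub hx) θ).differentiableAt (by simp)).hasFDerivAt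
    have h2 : HasFDerivAt (fun x : Y => (x, θ)) (ContinuousLinearMap.inl ℝ Y ℝ) x :=
      hasFDerivAt_prodMk_left x θ
    exact HasFDerivAt.comp x h1 h2

lemma contDiffOn_param {Y : Type} [NormedAddCommGroup Y] [NormedSpace ℝ Y]
    [ProperSpace Y] (V : Set Y) (hV : IsOpen V) (a b : ℝ) (n : ℕ) :
    ∀ {B : Type} [NormedAddCommGroup B] [NormedSpace ℝ B] (F : Y × ℝ → B),
    (∀ y ∈ V, ∀ θ, ContDiffAt ℝ (⊤ : ℕ∞) F (y, θ)) →
    ContDiffOn ℝ n (fun y => ∫ θ in a..b, F (y, θ)) V := by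
  induction n with
  | zero =>
    intro B _ _ F hF
    simp only [Nat.cast_zero, contDiffOn_zero]
    intro y hy
    exact (hasFDerivAt_param F V hV a b hF y hy).continuousAt.continuousWithinAt
  | succ n ih =>
    intro B _ _ F hF
    push_cast
    rw [contDiffOn_succ_iff_fderiv_of_isOpen hV]
    refine ⟨fun y hy => (hasFDerivAt_param F V hV a b hF y hy).differentiableAt.differentiableWithinAt,
      by simp, ?_⟩
    have := ih (fun p => (fderiv ℝ F p).comp (ContinuousLinearMap.inl ℝ Y ℝ)) (by
      intro y hy θ
      have : ContDiffAt ℝ (⊤ : ℕ∞) (fderiv ℝ F) (y, θ) :=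
        (hF y hy θ).fderiv_right (by simp)
      exact this.clm_comp contDiffAt_const)
    exact this.congr fun y hy => (hasFDerivAt_param F V hV a b hF y hy).fderiv

end Param

section Riesz

variable {N : ℕ}

/-- The Riesz projector of a matrix. -/
noncomputable def rieszMat (a : Matrix (Fin N) (Fin N) ℂ) : Matrix (Fin N) (Fin N) ℂ :=
  (2 * Real.pi * Complex.I)⁻¹ •
    ∮ z in C(1, 1 / 2), (z • (1 : Matrix (Fin N) (Fin N) ℂ) - a)⁻¹

lemma proj_norm_le_one (e : Matrix (Fin N) (Fin N) ℂ) (h : e * e = e) (hs : eᴴ = e) : ‖e‖ ≤ 1 := by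
  have h1 : ‖e‖ * ‖e‖ = ‖e‖ := by
    rw [← Matrix.l2_opNorm_conjTranspose_mul_self, hs, h]
  nlinarith [norm_nonneg e]

lemma isUnit_resolvent (a e : Matrix (Fin N) (Fin N) ℂ) (ha : aᴴ = a) (h : e * e = e) (hs : eᴴ = e)
    (h1 : ‖a - e‖ < 1 / 2) (h2 : ‖a‖ < 3 / 2) (z : ℂ) (hz : ‖z - 1‖ = 1 / 2) :
    IsUnit (z • (1 : Matrix (Fin N) (Fin N) ℂ) - a) := by
  by_contra hcon
  have hspec : z ∈ spectrum ℂ a := by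
    rw [spectrum.mem_iff, Algebra.algebraMap_eq_smul_one]; exact hcon
  have hre : z = z.re := IsSelfAdjoint.mem_spectrum_eq_re (A := Matrix (Fin N) (Fin N) ℂ) ha hspec
  set r := z.re with hr
  have hr' : |r - 1| = 1 / 2 := by
    rw [hre] at hz
    rw [← hz, ← Real.norm_eq_abs, ← Complex.norm_real]; push_cast; rfl
  apply hcon
  rcases (abs_eq (by norm_num : (0 : ℝ) ≤ 1 / 2)).mp hr' with h3 | h3
  · have hz' : z = 3 / 2 := by
      rw [hre, show r = 3 / 2 by linarith]; push_cast; rfl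
    have : z • (1 : Matrix (Fin N) (Fin N) ℂ) - a = (3 / 2 : ℂ) • (1 - (2 / 3 : ℂ) • a) := by
      rw [hz', smul_sub, smul_smul]; norm_num
    rw [this]
    have hu : IsUnit (1 - (2 / 3 : ℂ) • a) := by
      apply isUnit_one_sub_of_norm_lt_one
      rw [norm_smul]
      norm_num
      linarith
    exact hu.smul (Units.mk0 (3 / 2 : ℂ) (by norm_num))
  · have hz' : z = 1 / 2 := by
      rw [hre, show r = 1 / 2 by linarith]; push_cast; rfl
    set u : Matrix (Fin N) (Fin N) ℂ := 1 - (2 : ℂ) • e with hu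
    have huu : u * u = 1 := by
      rw [hu]; simp only [sub_mul, mul_sub, one_mul, mul_one, smul_mul_assoc, mul_smul_comm, h]
      module
    have hus : uᴴ = u := by
      rw [hu, conjTranspose_sub, conjTranspose_smul, conjTranspose_one, hs]; simp
    have hun : ‖u‖ ≤ 1 := by
      have hone : ‖(1 : Matrix (Fin N) (Fin N) ℂ)‖ ≤ 1 := proj_norm_le_one 1 (by simp) (by simp)
      have : ‖u‖ * ‖u‖ ≤ 1 := by
        rw [← Matrix.l2_opNorm_conjTranspose_mul_self, hus, huu]; exact hone
      nlinarith [norm_nonneg u]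
    have : z • (1 : Matrix (Fin N) (Fin N) ℂ) - a =
        (1 / 2 : ℂ) • (u * (1 - (2 : ℂ) • (u * (a - e)))) := by
      rw [mul_sub, mul_smul_comm, ← mul_assoc, huu, hz', hu]
      simp only [mul_one, one_mul]
      module
    rw [this]
    have hu1 : IsUnit u := IsUnit.of_mul_eq_one u huu
    have hu2 : IsUnit (1 - (2 : ℂ) • (u * (a - e))) := by
      apply isUnit_one_sub_of_norm_lt_one
      rw [norm_smul]
      have := norm_mul_le u (a - e)
      have h5 : ‖u‖ * ‖a - e‖ ≤ ‖a - e‖ := mul_le_of_le_one_left (norm_nonneg _) hun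
      norm_num
      linarith
    exact (hu1.mul hu2).smul (Units.mk0 (1 / 2 : ℂ) (by norm_num))

lemma riesz_scalar (w : ℂ) (hw : ‖w - 1‖ ≠ 1 / 2) :
    ((2 * Real.pi * Complex.I)⁻¹ * ∮ z in C(1, 1 / 2), (z - w)⁻¹) *
      ((2 * Real.pi * Complex.I)⁻¹ * ∮ z in C(1, 1 / 2), (z - w)⁻¹) =
      ((2 * Real.pi * Complex.I)⁻¹ * ∮ z in C(1, 1 / 2), (z - w)⁻¹) := by
  rcases lt_or_gt_of_ne hw with h | h
  · rw [circleIntegral.integral_sub_inv_of_mem_ball (by simpa [dist_eq_norm] using h),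
      inv_mul_cancel₀ Complex.two_pi_I_ne_zero, mul_one]
  · have : (∮ z in C(1, 1 / 2), (z - w)⁻¹) = 0 := by
      refine DiffContOnCl.circleIntegral_eq_zero (by norm_num) ?_
      refine DifferentiableOn.diffContOnCl ?_
      rw [closure_ball _ (by norm_num)]
      intro z hz
      have hzw : z - w ≠ 0 := by
        intro hzw
        rw [sub_eq_zero] at hzw
        rw [hzw, mem_closedBall_iff_norm] at hz
        linarith
      exact ((differentiableAt_id.sub_const w).inv hzw).differentiableWithinAt
    rw [this]; simp

lemma rieszMat_idem (a : Matrix (Fin N) (Fin N) ℂ) (ha : aᴴ = a)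
    (hu : ∀ z : ℂ, ‖z - 1‖ = 1 / 2 → IsUnit (z • (1 : Matrix (Fin N) (Fin N) ℂ) - a)) :
    rieszMat a * rieszMat a = rieszMat a := by
  have hH : a.IsHermitian := ha
  set U : Matrix (Fin N) (Fin N) ℂ := (hH.eigenvectorUnitary : Matrix (Fin N) (Fin N) ℂ) with hU
  have hU1 : star U * U = 1 := Unitary.coe_star_mul_self hH.eigenvectorUnitary
  have hU2 : U * star U = 1 := Unitary.coe_mul_star_self hH.eigenvectorUnitary
  set l : Fin N → ℂ := fun i => (hH.eigenvalues i : ℂ) with hl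
  have hsp : a = U * diagonal l * star U := by
    have := hH.spectral_theorem
    rw [Unitary.conjStarAlgAut_apply] at this
    exact this
  have hcirc : ∀ z : ℂ, ‖z - 1‖ = 1 / 2 → ∀ i, z - l i ≠ 0 := by
    intro z hz i h0
    have h1 := hu z hz
    have h2 : z • (1 : Matrix (Fin N) (Fin N) ℂ) - a = U * diagonal (fun i => z - l i) * star U := by
      have : diagonal (fun i => z - l i) = z • (1 : Matrix (Fin N) (Fin N) ℂ) - diagonal l := by
        ext i j; by_cases hij : i = j <;> simp [hij]
      rw [this, mul_sub, sub_mul, ← hsp, mul_smul_comm, mul_one, smul_mul_assoc, hU2]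
    rw [Matrix.isUnit_iff_isUnit_det, h2, det_mul, det_mul, det_diagonal,
      Finset.prod_eq_zero (Finset.mem_univ i) h0] at h1
    simp at h1
  have hres : ∀ z : ℂ, ‖z - 1‖ = 1 / 2 → (z • (1 : Matrix (Fin N) (Fin N) ℂ) - a)⁻¹ =
      ∑ i, (z - l i)⁻¹ • (U * diagonal (Pi.single i 1) * star U) := by
    intro z hz
    have h3 : ∑ i, (z - l i)⁻¹ • (U * diagonal (Pi.single i 1) * star U) =
        U * diagonal (fun i => (z - l i)⁻¹) * star U := by
      have : diagonal (fun i => (z - l i)⁻¹) = ∑ i, (z - l i)⁻¹ • diagonal (Pi.single i (1 : ℂ)) := by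
        ext j k
        rw [Matrix.sum_apply]
        by_cases hjk : j = k
        · subst hjk; simp [Pi.single_apply]
        · simp [hjk]
      rw [this, Finset.mul_sum, Finset.sum_mul]
      simp
    rw [h3]
    apply Matrix.inv_eq_right_inv
    have h2 : z • (1 : Matrix (Fin N) (Fin N) ℂ) - a = U * diagonal (fun i => z - l i) * star U := by
      have : diagonal (fun i => z - l i) = z • (1 : Matrix (Fin N) (Fin N) ℂ) - diagonal l := by
        ext i j; by_cases hij : i = j <;> simp [hij]
      rw [this, mul_sub, sub_mul, ← hsp, mul_smul_comm, mul_one, smul_mul_assoc, hU2]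
    rw [h2]
    calc U * diagonal (fun i => z - l i) * star U * (U * diagonal (fun i => (z - l i)⁻¹) * star U)
        = U * diagonal (fun i => z - l i) * (star U * U) * diagonal (fun i => (z - l i)⁻¹) * star U := by
          simp only [mul_assoc]
      _ = 1 := by
          rw [hU1, mul_one, mul_assoc U, diagonal_mul_diagonal]
          have : (fun i => (z - l i) * (z - l i)⁻¹) = fun _ => (1 : ℂ) := by
            funext i; exact mul_inv_cancel₀ (hcirc z hz i)
          rw [this, diagonal_one, mul_one, hU2]
  let c : Fin N → ℂ := fun i => (2 * Real.pi * Complex.I)⁻¹ * ∮ z in C(1, 1 / 2), (z - l i)⁻¹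
  have hR : rieszMat a = U * diagonal c * star U := by
    have h4 : (∮ z in C(1, 1 / 2), (z • (1 : Matrix (Fin N) (Fin N) ℂ) - a)⁻¹) =
        ∑ i, (∮ z in C(1, 1 / 2), (z - l i)⁻¹) • (U * diagonal (Pi.single i 1) * star U) := by
      rw [circleIntegral.integral_congr (by norm_num) (g := fun z =>
        ∑ i, (z - l i)⁻¹ • (U * diagonal (Pi.single i 1) * star U))
        (fun z hz => hres z (by simpa [dist_eq_norm] using hz))]
      simp_rw [← circleIntegral.integral_smul_const]
      rw [circleIntegral.integral_fun_sum]
      intro i _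
      refine ContinuousOn.circleIntegrable (by norm_num) ?_
      have hci : ContinuousOn (fun z : ℂ => (z - l i)⁻¹) (Metric.sphere 1 (1 / 2)) := by
        refine ContinuousOn.inv₀ (by fun_prop) ?_
        intro z hz
        exact hcirc z (by simpa [dist_eq_norm] using hz) i
      exact ContinuousOn.smul hci continuousOn_const
    have : diagonal c = ∑ i, c i • diagonal (Pi.single i (1 : ℂ)) := by
      ext j k
      rw [Matrix.sum_apply]
      by_cases hjk : j = k
      · subst hjk; simp [Pi.single_apply]
      · simp [hjk]
    rw [rieszMat, h4, this, Finset.smul_sum, Finset.mul_sum, Finset.sum_mul]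
    refine Finset.sum_congr rfl fun i _ => ?_
    simp [c, smul_smul]
  have hc : (fun i => c i * c i) = c := by
    funext i
    refine riesz_scalar (l i) fun h => ?_
    exact hcirc (l i) h i (sub_self _)
  calc rieszMat a * rieszMat a = U * diagonal c * (star U * U) * diagonal c * star U := by
        rw [hR]; simp only [mul_assoc]
    _ = rieszMat a := by
        rw [hU1, mul_one, mul_assoc U, diagonal_mul_diagonal, hc, hR]

lemma contDiffOn_riesz {m : ℕ} (a : (Fin m → ℝ) → Matrix (Fin N) (Fin N) ℂ)
    (ha : ContDiff ℝ (⊤ : ℕ∞) a) (V : Set (Fin m → ℝ)) (hV : IsOpen V)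
    (hu : ∀ y ∈ V, ∀ z : ℂ, ‖z - 1‖ = 1 / 2 → IsUnit (z • (1 : Matrix (Fin N) (Fin N) ℂ) - a y)) :
    ContDiffOn ℝ 2 (fun y => rieszMat (a y)) V := by
  unfold rieszMat
  refine ContDiffOn.const_smul _ ?_
  have := contDiffOn_param V hV 0 (2 * Real.pi) 2
    (fun p : (Fin m → ℝ) × ℝ => deriv (circleMap 1 (1 / 2)) p.2 •
      (circleMap 1 (1 / 2) p.2 • (1 : Matrix (Fin N) (Fin N) ℂ) - a p.1)⁻¹) ?_
  · exact this
  intro y hy θ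
  have hcm : ContDiff ℝ (⊤ : ℕ∞) (circleMap 1 (1 / 2)) := contDiff_circleMap _ _
  have h1 : ContDiff ℝ (⊤ : ℕ∞) fun p : (Fin m → ℝ) × ℝ => deriv (circleMap 1 (1 / 2)) p.2 := by
    simp only [deriv_circleMap]
    exact ((contDiff_circleMap 0 (1 / 2)).comp contDiff_snd).mul contDiff_const
  refine h1.contDiffAt.smul ?_
  simp only [Matrix.nonsing_inv_eq_ringInverse]
  obtain ⟨u, hu⟩ := hu y hy (circleMap 1 (1 / 2) θ) (by simp [circleMap])
  have h2 : ContDiffAt ℝ (⊤ : ℕ∞) (Ring.inverse : Matrix (Fin N) (Fin N) ℂ → _)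
      (circleMap 1 (1 / 2) θ • (1 : Matrix (Fin N) (Fin N) ℂ) - a y) := by
    rw [← hu]; exact contDiffAt_ringInverse ℝ u
  refine ContDiffAt.comp (f := fun p : (Fin m → ℝ) × ℝ =>
    circleMap 1 (1 / 2) p.2 • (1 : Matrix (Fin N) (Fin N) ℂ) - a p.1) (y, θ) h2 ?_
  exact (((hcm.comp contDiff_snd).smul contDiff_const).sub (ha.comp contDiff_fst)).contDiffAt

end Riesz

open scoped Matrix.Norms.L2Operator
open Matrix MeasureTheory

section Assembly

/-- The linear change of coordinates from order coordinates to barycentric coordinates. -/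
noncomputable def ordL (n : ℕ) : (Fin n → ℝ) →L[ℝ] (Fin n → ℝ) :=
  ContinuousLinearMap.pi fun i => ordYL n ((i : ℕ) + 1) - ordYL n ((i : ℕ) + 2)

lemma ordYL_succ_apply {n : ℕ} (k : ℕ) (y : Fin n → ℝ) : ordYL n (k + 1) y = ordY y (k + 1) := by
  simp only [ordYL, ordY_succ]
  split_ifs <;> rfl

lemma ordL_apply {n : ℕ} (y : Fin n → ℝ) (i : Fin n) :
    ordL n y i = ordY y ((i : ℕ) + 1) - ordY y ((i : ℕ) + 2) := by
  simp only [ordL, ContinuousLinearMap.coe_pi', _root_.sub_apply,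
    ordYL_succ_apply (_ + 1), ordYL_succ_apply]

lemma ordL_sum {n : ℕ} (y : Fin n → ℝ) : ∑ i, ordL n y i = ordY y 1 := by
  simp_rw [ordL_apply]
  rw [Fin.sum_univ_eq_sum_range (fun i => ordY y (i + 1) - ordY y (i + 2)) n,
    Finset.sum_range_sub' (fun i => ordY y (i + 1)) n, ordY_of_gt y (n + 1) (by omega)]
  simp

lemma ordL_injective (n : ℕ) : Function.Injective (ordL n) := by
  rw [injective_iff_map_eq_zero]
  intro y hy
  have h1 : ∀ k, ordY y (k + 1) = ordY y (k + 2) := by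
    intro k
    by_cases hk : k < n
    · have := congrFun hy ⟨k, hk⟩
      rw [ordL_apply] at this
      simpa [sub_eq_zero] using this
    · rw [ordY_of_gt _ _ (by omega), ordY_of_gt _ _ (by omega)]
  have h2 : ∀ d k, ordY y (k + 1) = ordY y (k + 1 + d) := by
    intro d
    induction d with
    | zero => intro k; rfl
    | succ d ih => intro k; rw [ih k, show k + 1 + d = (k + d) + 1 by ring, h1]; congr 1; ring
  funext i
  rw [← ordY_fin y i, h2 n i, ordY_of_gt _ _ (by omega)]
  rfl

lemma ordL_surjective (n : ℕ) : Function.Surjective (ordL n) :=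
  (LinearMap.injective_iff_surjective (f := (ordL n : (Fin n → ℝ) →ₗ[ℝ] (Fin n → ℝ)))).mp
    (ordL_injective n)

lemma ordL_mem {n : ℕ} (y : Fin n → ℝ) : ordL n y ∈ simplexΔ n ↔ y ∈ ordO n := by
  simp only [simplexΔ, ordO, Set.mem_ofPred_eq, ordL_sum]
  simp only [ordL_apply, sub_nonneg]
  constructor
  · rintro ⟨h1, h2⟩ k
    cases k with
    | zero => simpa [ordY_zero] using h2
    | succ k =>
      by_cases hk : k < n
      · exact h1 ⟨k, hk⟩
      · rw [ordY_of_gt _ _ (by omega), ordY_of_gt _ _ (by omega)]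
  · intro h
    exact ⟨fun i => h _, by simpa [ordY_zero] using h 0⟩

lemma ordL_image (n : ℕ) : ordL n '' ordO n = simplexΔ n := by
  ext t
  constructor
  · rintro ⟨y, hy, rfl⟩; exact (ordL_mem y).mpr hy
  · intro ht
    obtain ⟨y, rfl⟩ := ordL_surjective n t
    exact ⟨y, (ordL_mem y).mp ht, rfl⟩

lemma ordL_det_ne_zero (n : ℕ) : (ordL n).det ≠ 0 := by
  have : (ordL n : (Fin n → ℝ) →ₗ[ℝ] (Fin n → ℝ)).ker = ⊥ :=
    LinearMap.ker_eq_bot.mpr (ordL_injective n)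
  intro h
  have h2 := LinearMap.bot_lt_ker_of_det_eq_zero (f := (ordL n : (Fin n → ℝ) →ₗ[ℝ] (Fin n → ℝ))) h
  rw [this] at h2
  exact lt_irrefl _ h2

lemma integral_simplex_eq {n : ℕ} (g : (Fin n → ℝ) → ℂ) :
    ∫ t in simplexΔ n, g t = ((|(ordL n).det| : ℝ) : ℂ) * ∫ y in ordO n, g (ordL n y) := by
  rw [← ordL_image, integral_image_eq_integral_abs_det_fderiv_smul volume
    (isClosed_ordO n).measurableSet (f' := fun _ => ordL n)
    (fun x _ => (ordL n).hasFDerivAt.hasFDerivWithinAt) (ordL_injective n).injOn,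
    ← integral_const_mul]
  simp

section Top
variable {A : Type*} [NormedRing A] [NormedAlgebra ℝ A]

lemma alt_top {n : ℕ} (f : (Fin n → ℝ) [⋀^Fin n]→ₗ[ℝ] ℂ) (L : (Fin n → ℝ) →ₗ[ℝ] (Fin n → ℝ)) :
    f (fun k => L (Pi.single k 1)) = ((LinearMap.det L : ℝ) : ℂ) * f (fun k => Pi.single k 1) := by
  have hb : ∀ v : Fin n → (Fin n → ℝ), f v = (Pi.basisFun ℝ (Fin n)).det v • f (Pi.basisFun ℝ (Fin n)) := by
    have : f = (LinearMap.toSpanSingleton ℝ ℂ (f (Pi.basisFun ℝ (Fin n)))).compAlternatingMap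
        (Pi.basisFun ℝ (Fin n)).det := by
      refine Module.Basis.ext_alternating (Pi.basisFun ℝ (Fin n)) fun v hv => ?_
      obtain ⟨σ, rfl⟩ : ∃ σ : Equiv.Perm (Fin n), v = σ :=
        ⟨Equiv.ofBijective v (Finite.injective_iff_bijective.mp hv), rfl⟩
      have e1 := f.map_perm (Pi.basisFun ℝ (Fin n)) σ
      have e2 := (Pi.basisFun ℝ (Fin n)).det.map_perm (Pi.basisFun ℝ (Fin n)) σ
      simp only [Function.comp_def] at e1 e2
      simp only [LinearMap.compAlternatingMap_apply, LinearMap.toSpanSingleton_apply]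
      rw [e1, e2, Module.Basis.det_self]
      rcases Int.units_eq_one_or (Equiv.Perm.sign σ) with h | h <;> rw [h] <;> simp
    intro v
    conv_lhs => rw [this]
    simp
  have hbasis : (fun k => Pi.single k (1 : ℝ) : Fin n → (Fin n → ℝ)) = Pi.basisFun ℝ (Fin n) := by
    funext k; simp
  have hL : (fun k => L (Pi.single k 1)) = L ∘ (Pi.basisFun ℝ (Fin n)) := by
    funext k; simp
  rw [hbasis, hL, hb, Module.Basis.det_comp, Module.Basis.det_self]
  simp

/-- The trace form as an alternating map. -/
noncomputable def traceAlt (T : A →L[ℝ] ℂ) {n : ℕ} (E : (Fin n → ℝ) → A) (x : Fin n → ℝ) :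
    (Fin n → ℝ) [⋀^Fin n]→ₗ[ℝ] ℂ :=
  MultilinearMap.alternatization
    ((((T : A →ₗ[ℝ] ℂ) ∘ₗ LinearMap.mulLeft ℝ (E x)).compMultilinearMap
      (MultilinearMap.mkPiAlgebraFin ℝ n A)).compLinearMap
        (fun _ => (fderiv ℝ E x : (Fin n → ℝ) →ₗ[ℝ] A)))

lemma traceAlt_apply (T : A →L[ℝ] ℂ) {n : ℕ} (E : (Fin n → ℝ) → A) (x : Fin n → ℝ)
    (v : Fin n → Fin n → ℝ) : traceAlt T E x v = traceForm T E n x v := by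
  rw [traceAlt, MultilinearMap.alternatization_apply, traceForm]
  refine Finset.sum_congr rfl fun σ _ => ?_
  rw [Units.smul_def, zsmul_eq_mul]
  congr 1

lemma traceForm_comp_ordL (T : A →L[ℝ] ℂ) {n : ℕ} (E : (Fin n → ℝ) → A) (y : Fin n → ℝ)
    (hE : DifferentiableAt ℝ E (ordL n y)) :
    traceForm T (E ∘ ordL n) n y (fun k => Pi.single k 1) =
      (((ordL n).det : ℝ) : ℂ) * traceForm T E n (ordL n y) (fun k => Pi.single k 1) := by
  have h1 : traceForm T (E ∘ ordL n) n y (fun k => Pi.single k 1) =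
      traceForm T E n (ordL n y) (fun k => ordL n (Pi.single k 1)) := by
    have : ∀ v, fderiv ℝ (E ∘ ordL n) y v = fderiv ℝ E (ordL n y) (ordL n v) := by
      intro v
      rw [(hE.hasFDerivAt.comp y (ordL n).hasFDerivAt).fderiv]; rfl
    unfold traceForm preForm
    refine Finset.sum_congr rfl fun σ _ => ?_
    simp only [this]
    rfl
  rw [h1, ← traceAlt_apply, ← traceAlt_apply]
  exact alt_top (traceAlt T E (ordL n y)) (ordL n : (Fin n → ℝ) →ₗ[ℝ] (Fin n → ℝ))

end Top

variable {N : ℕ}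

lemma simplexComb_eq {n : ℕ} (e : Fin (n + 1) → Matrix (Fin N) (Fin N) ℂ) (t : Fin n → ℝ) :
    simplexComb e t =
      ∑ k, (Fin.cons (1 - ∑ i, t i) t : Fin (n + 1) → ℝ) k • e k := by
  rw [Fin.sum_univ_succ]
  simp only [simplexComb, Fin.cons_zero, Fin.cons_succ, Complex.coe_smul]

lemma simplexComb_ordL {n : ℕ} (e : Fin (n + 1) → Matrix (Fin N) (Fin N) ℂ) (y : Fin n → ℝ) :
    simplexComb e (ordL n y) = ∑ k : Fin (n + 1), (ordY y k - ordY y (k + 1)) • e k := by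
  rw [simplexComb_eq, Fin.sum_univ_succ, Fin.sum_univ_succ, ordL_sum]
  simp only [Fin.cons_zero, Fin.cons_succ, ordL_apply, Fin.val_succ, Fin.val_zero, ordY_zero]

lemma simplexComb_face {n : ℕ} (e : Fin (n + 2) → Matrix (Fin N) (Fin N) ℂ) (j : Fin (n + 2))
    (z : Fin n → ℝ) :
    simplexComb (fun i => e (j.succAbove i)) (ordL n z) =
      simplexComb e (ordL (n + 1) (ordFace j z)) := by
  rw [simplexComb_ordL, simplexComb_ordL, Fin.sum_univ_succAbove _ j]
  have hj : (j : ℕ) ≤ n + 1 := by omega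
  simp only [ordY_ordFace _ hj]
  rw [if_pos le_rfl, if_neg (by omega), Nat.add_sub_cancel, sub_self, zero_smul, zero_add]
  refine Finset.sum_congr rfl fun i _ => ?_
  congr 1
  by_cases h : i.castSucc < j
  · rw [Fin.succAbove_of_castSucc_lt _ _ h]
    have h' : (i : ℕ) < j := h
    simp only [Fin.val_castSucc]
    rw [if_pos (by omega), if_pos (by omega)]
  · rw [Fin.succAbove_of_le_castSucc _ _ (not_lt.mp h)]
    have h' : (j : ℕ) ≤ i := not_lt.mp h
    simp only [Fin.val_succ]
    rw [if_neg (by omega), if_neg (by omega)]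
    rfl

lemma simplexComb_hermitian {n : ℕ} (e : Fin (n + 1) → Matrix (Fin N) (Fin N) ℂ)
    (hsa : ∀ j, (e j)ᴴ = e j) (t : Fin n → ℝ) : (simplexComb e t)ᴴ = simplexComb e t := by
  simp only [simplexComb, conjTranspose_add, conjTranspose_sum, conjTranspose_smul, hsa]
  simp

lemma contDiff_simplexComb {n : ℕ} (e : Fin (n + 1) → Matrix (Fin N) (Fin N) ℂ) :
    ContDiff ℝ (⊤ : ℕ∞) (simplexComb e) := by
  have : simplexComb e = fun t => (1 - ∑ i, t i) • e 0 + ∑ i : Fin n, t i • e i.succ := by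
    funext t; simp only [simplexComb, Complex.coe_smul]
  rw [this]
  have h : ∀ i : Fin n, ContDiff ℝ (⊤ : ℕ∞) fun t : Fin n → ℝ => t i := fun i => contDiff_apply _ _ i
  refine ContDiff.add ?_ ?_
  · exact (contDiff_const.sub (ContDiff.sum fun i _ => h i)).smul contDiff_const
  · exact ContDiff.sum fun i _ => (h i).smul contDiff_const

lemma riesz_good {n : ℕ} (e : Fin (n + 1) → Matrix (Fin N) (Fin N) ℂ)
    (hidem : ∀ j, e j * e j = e j) (hsa : ∀ j, (e j)ᴴ = e j)
    (hclose : ∀ k l, ‖e k - e l‖ < 1 / 2) (t : Fin n → ℝ) (ht : t ∈ simplexΔ n) :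
    ContDiffAt ℝ 2 (rieszComb e) t ∧
      ∀ᶠ s in nhds t, rieszComb e s * rieszComb e s = rieszComb e s := by
  set V : Set (Fin n → ℝ) := simplexComb e ⁻¹' (Metric.ball (e 0) (1 / 2) ∩ Metric.ball 0 (3 / 2))
    with hVdef
  have hV : IsOpen V :=
    (Metric.isOpen_ball.inter Metric.isOpen_ball).preimage (contDiff_simplexComb e).continuous
  have hmem : ∀ S : Set (Matrix (Fin N) (Fin N) ℂ), Convex ℝ S → (∀ k, e k ∈ S) →
      simplexComb e t ∈ S := by
    intro S hS hk
    rw [simplexComb_eq]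
    refine hS.sum_mem (fun k _ => ?_) ?_ (fun k _ => hk k)
    · refine Fin.cases ?_ (fun i => ?_) k
      · simpa using ht.2
      · simpa using ht.1 i
    · rw [Fin.sum_univ_succ]; simp
  have htV : t ∈ V := by
    refine ⟨hmem _ (convex_ball _ _) fun k => ?_, hmem _ (convex_ball _ _) fun k => ?_⟩
    · rw [mem_ball_iff_norm]; exact hclose k 0
    · rw [mem_ball_zero_iff]
      have := proj_norm_le_one (e k) (hidem k) (hsa k)
      linarith
  have hu : ∀ y ∈ V, ∀ z : ℂ, ‖z - 1‖ = 1 / 2 →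
      IsUnit (z • (1 : Matrix (Fin N) (Fin N) ℂ) - simplexComb e y) := by
    rintro y ⟨h1, h2⟩ z hz
    exact isUnit_resolvent _ (e 0) (simplexComb_hermitian e hsa y) (hidem 0) (hsa 0)
      (mem_ball_iff_norm.mp h1) (mem_ball_zero_iff.mp h2) z hz
  constructor
  · exact (contDiffOn_riesz (simplexComb e) (contDiff_simplexComb e) V hV hu).contDiffAt
      (hV.mem_nhds htV)
  · filter_upwards [hV.mem_nhds htV] with s hs
    exact rieszMat_idem (simplexComb e s) (simplexComb_hermitian e hsa s) (hu s hs)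

/-- The trace as a continuous real-linear map. -/
noncomputable def traceT (N : ℕ) : Matrix (Fin N) (Fin N) ℂ →L[ℝ] ℂ :=
  LinearMap.toContinuousLinearMap (Matrix.traceLinearMap (Fin N) ℝ ℂ)

lemma traceT_apply (a : Matrix (Fin N) (Fin N) ℂ) : traceT N a = Matrix.trace a := rfl

lemma chEven_eq {n : ℕ} (e : Fin (n + 1) → Matrix (Fin N) (Fin N) ℂ)
    (hE : ∀ t ∈ simplexΔ n, DifferentiableAt ℝ (rieszComb e) t) :
    (((ordL n).det : ℝ) : ℂ) * chEven n N e = evenChernConst n * ((|(ordL n).det| : ℝ) : ℂ) *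
      ∫ z in ordO n, traceForm (traceT N) (rieszComb e ∘ ordL n) n z (fun k => Pi.single k 1) := by
  have h1 : chEven n N e = evenChernConst n * ∫ t in simplexΔ n,
      traceForm (traceT N) (rieszComb e) n t (fun k => Pi.single k 1) := by
    rw [chEven]
    congr 2
    funext t
    unfold traceForm preForm
    refine Finset.sum_congr rfl fun σ _ => ?_
    rw [traceT_apply, ContinuousMultilinearMap.mkPiAlgebraFin_apply, List.ofFn_eq_map]
    rfl
  have h2 : ∫ z in ordO n, traceForm (traceT N) (rieszComb e ∘ ordL n) n z (fun k => Pi.single k 1)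
      = (((ordL n).det : ℝ) : ℂ) * ∫ z in ordO n,
        traceForm (traceT N) (rieszComb e) n (ordL n z) (fun k => Pi.single k 1) := by
    rw [← integral_const_mul]
    refine setIntegral_congr_fun (isClosed_ordO n).measurableSet fun z hz => ?_
    exact traceForm_comp_ordL (traceT N) (rieszComb e) z (hE _ ((ordL_mem z).mpr hz))
  rw [h1, h2, integral_simplex_eq]
  ring

end Assembly

/-- for `n` even and pairwise close self-adjoint idempotents, the spectral
projector family is differentiable on the relevant simplices and the Alexander–Spanier
coboundary of `Chⁿ` vanishes. -/
theorem chEven_coboundary_eq_zero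
    (N n : ℕ) (hn : Even n)
    (e : Fin (n + 2) → Matrix (Fin N) (Fin N) ℂ)
    (hidem : ∀ j, e j * e j = e j) (hsa : ∀ j, (e j)ᴴ = e j)
    (hclose : ∀ k l, ‖e k - e l‖ < 1 / 2) :
    (∀ j : Fin (n + 2), ∀ t ∈ simplexΔ n,
        DifferentiableAt ℝ (rieszComb fun i => e (j.succAbove i)) t) ∧
      ∑ j : Fin (n + 2),
          ((-1 : ℂ) ^ (j : ℕ)) * chEven n N (fun i => e (j.succAbove i)) = 0 := by
  have hdiff : ∀ j : Fin (n + 2), ∀ t ∈ simplexΔ n,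
      DifferentiableAt ℝ (rieszComb fun i => e (j.succAbove i)) t := fun j t ht =>
    (riesz_good (fun i => e (j.succAbove i)) (fun _ => hidem _) (fun _ => hsa _)
      (fun _ _ => hclose _ _) t ht).1.differentiableAt (by norm_num)
  refine ⟨hdiff, ?_⟩
  have hst := ord_stokes (traceT N) (fun a b => Matrix.trace_mul_comm a b) hn
    (rieszComb e ∘ ordL (n + 1))
    (fun y hy => (riesz_good e hidem hsa hclose _ ((ordL_mem y).mpr hy)).1.comp y
      (ordL (n + 1)).contDiff.contDiffAt)
    (fun y hy => (ordL (n + 1)).continuous.continuousAt.eventually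
      (riesz_good e hidem hsa hclose _ ((ordL_mem y).mpr hy)).2)
  have hface : ∀ j : Fin (n + 2), (rieszComb e ∘ ordL (n + 1)) ∘ ordFace j =
      rieszComb (fun i => e (j.succAbove i)) ∘ ordL n := by
    intro j
    funext z
    simp only [Function.comp, rieszComb, simplexComb_face]
  simp_rw [hface] at hst
  have hdet : (((ordL n).det : ℝ) : ℂ) ≠ 0 := by exact_mod_cast ordL_det_ne_zero n
  refine (mul_eq_zero.mp ?_).resolve_left hdet
  rw [Finset.mul_sum]
  have : ∀ j : Fin (n + 2), (((ordL n).det : ℝ) : ℂ) *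
      ((-1 : ℂ) ^ (j : ℕ) * chEven n N (fun i => e (j.succAbove i))) =
      (evenChernConst n * ((|(ordL n).det| : ℝ) : ℂ)) * ((-1 : ℂ) ^ (j : ℕ) *
      ∫ z in ordO n, traceForm (traceT N) (rieszComb (fun i => e (j.succAbove i)) ∘ ordL n) n z
        (fun k => Pi.single k 1)) := by
    intro j
    rw [mul_left_comm, chEven_eq _ (hdiff j)]
    ring
  simp_rw [this]
  rw [← Finset.mul_sum, hst, mul_zero]
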